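/- arXiv:1411.6493 — 5 statements merged into one kernel-verified Lean document; each statement's English description precedes it below -/
import Mathlib

section
/- Let a ∈ ℂ with a ≠ 0, b, c, d, e ∈ ℂ, and p(z) = a(z⁴ + bz³ + cz² + dz + e). Let α ∈ ℂ and ξ ∈ ℂ with ξ ≠ 0 and ξ² = α + b²/4 − c, and set χ = (αb − 2d)/(4ξ²). Let ν₀ be the derivation with components ν₀(x) = −(p'''(z)/6)·x − p'(z), ν₀(y) = (p'''(z)/6)·y + a·p'(z), ν₀(z) = a·x − y. Then for every (x,y,z) ∈ ℂ³ satisfying x·y = p(z) and a·x + y + 2a·z² + a·b·z + a·α = 0, putting t = (a·x − y)/(2a) + ξ·(z + χ), one has (a·ν₀(x) − ν₀(y))/(2a) + ξ·ν₀(z) = 2aξ·t. (That is, the vector field ν₀ acts on the coordinate t of the fiber C^α as multiplication by 2aξ, so ν₀ restricts to 2aξ·t ∂/∂t ≅ a hyperbolic field on C^α ≅ ℂ*.) -/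
/-- On the fiber `C^α` of the Danielewski surface
`S = {xy = p(z)}`, `p(z) = a(z⁴+bz³+cz²+dz+e)`, the vector field
`ν₀ = −(p'''(z)/6)·HF + a·SF^x − SF^y` acts on the fiber coordinate
`t = (ax−y)/(2a) + ξ(z+χ)` as multiplication by `2aξ`. -/
theorem stmt1 (a b c d e : ℂ) (ha : a ≠ 0)
    (p p' p''' : ℂ → ℂ)
    (hp : ∀ w, p w = a * (w ^ 4 + b * w ^ 3 + c * w ^ 2 + d * w + e))
    (hp' : ∀ w, p' w = a * (4 * w ^ 3 + 3 * b * w ^ 2 + 2 * c * w + d))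
    (hp''' : ∀ w, p''' w = a * (24 * w + 6 * b))
    (α ξ χ : ℂ) (hξ : ξ ≠ 0) (hξ2 : ξ ^ 2 = α + b ^ 2 / 4 - c)
    (hχ : χ = (α * b - 2 * d) / (4 * ξ ^ 2))
    (x y z : ℂ)
    (hS : x * y = p z)
    (hC : a * x + y + 2 * a * z ^ 2 + a * b * z + a * α = 0)
    (t : ℂ) (ht : t = (a * x - y) / (2 * a) + ξ * (z + χ))
    (νx νy νz : ℂ)
    (hνx : νx = -(p''' z / 6) * x - p' z)
    (hνy : νy = p''' z / 6 * y + a * p' z)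
    (hνz : νz = a * x - y) :
    (a * νx - νy) / (2 * a) + ξ * νz = 2 * a * ξ * t := by
  have hχ' : 4 * ξ ^ 2 * χ = α * b - 2 * d := by
    rw [hχ]
    field_simp
  have key : a * νx - νy = 4 * a ^ 2 * ξ ^ 2 * (z + χ) := by
    rw [hνx, hνy, hp', hp''']
    linear_combination (-(a * (4 * z + b))) * hC - 4 * a ^ 2 * z * hξ2 - a ^ 2 * hχ'
  rw [key, hνz, ht]
  field_simp
  ring
end

section
/- Let a ∈ ℂ, a ≠ 0, b, c, d, e ∈ ℂ, p(z) = a(z⁴ + bz³ + cz² + dz + e). Let α ∈ ℂ, and let ξ ∈ ℂ satisfy ξ² = α + b²/4 − c with ξ ≠ 0; set χ = (αb − 2d)/(4ξ²) and κ = e − α²/4 + ξ²χ². Then for every (x,y,z) ∈ ℂ³ with x·y = p(z) and a·x + y + 2a·z² + a·b·z + a·α = 0, the number t = (a·x − y)/(2a) + ξ·(z + χ) satisfies t·(t − 2ξ(z + χ)) + κ = 0. (This exhibits the fiber C^α as a conic with coordinate t.) -/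
/-- On the fiber `C^α` of the Danielewski surface
`S = {xy = p(z)}` with `p(z) = a(z⁴+bz³+cz²+dz+e)`, the coordinate
`t = (ax−y)/(2a) + ξ(z+χ)` satisfies the conic equation
`t(t − 2ξ(z+χ)) + κ = 0`. -/
theorem stmt2 (a b c d e : ℂ) (ha : a ≠ 0)
    (α ξ χ κ : ℂ) (hξ : ξ ≠ 0) (hξ2 : ξ ^ 2 = α + b ^ 2 / 4 - c)
    (hχ : χ = (α * b - 2 * d) / (4 * ξ ^ 2))
    (hκ : κ = e - α ^ 2 / 4 + ξ ^ 2 * χ ^ 2)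
    (x y z : ℂ)
    (hS : x * y = a * (z ^ 4 + b * z ^ 3 + c * z ^ 2 + d * z + e))
    (hC : a * x + y + 2 * a * z ^ 2 + a * b * z + a * α = 0)
    (t : ℂ) (ht : t = (a * x - y) / (2 * a) + ξ * (z + χ)) :
    t * (t - 2 * ξ * (z + χ)) + κ = 0 := by
  have hlin : 4 * ξ ^ 2 * χ = α * b - 2 * d := by
    rw [hχ]
    field_simp
  have hsum : a * x + y = -(a * (2 * z ^ 2 + b * z + α)) := by linear_combination hC
  have hsq : ((a * x - y) / (2 * a)) ^ 2 =
      (2 * z ^ 2 + b * z + α) ^ 2 / 4 - (z ^ 4 + b * z ^ 3 + c * z ^ 2 + d * z + e) := by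
    have h : (a * x - y) ^ 2 = (a * (2 * z ^ 2 + b * z + α)) ^ 2
        - 4 * a ^ 2 * (z ^ 4 + b * z ^ 3 + c * z ^ 2 + d * z + e) := by
      linear_combination (a * x + y - a * (2 * z ^ 2 + b * z + α)) * hsum - 4 * a * hS
    rw [div_pow, h]
    field_simp
    ring
  rw [ht, hκ]
  linear_combination hsq - z ^ 2 * hξ2 - z / 2 * hlin
end

section
/- Let a ∈ ℂ, a ≠ 0, b, c, d, e ∈ ℂ, p(z) = a(z⁴ + bz³ + cz² + dz + e). Let α ∈ ℂ, ξ ∈ ℂ with ξ² = α + b²/4 − c and ξ ≠ 0, χ = (αb − 2d)/(4ξ²), κ = e − α²/4 + ξ²χ², and assume κ ≠ 0. Then the map (x,y,z) ↦ t = (a·x − y)/(2a) + ξ·(z + χ) is a bijection from the fiber C^α = {(x,y,z) ∈ ℂ³ : x·y = p(z) and a·x + y + 2a·z² + a·b·z + a·α = 0} onto ℂ* = ℂ \ {0}; its inverse sends t ∈ ℂ* to the point with z = (t² + κ)/(2ξt) − χ, x = t − ξ(z+χ) − z² − (b/2)z − α/2, and y = −a·(x + 2z² + bz + α). In particular the general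 fiber of the ℂ*-fibration f(x,y,z) = ax + y + p''(z)/6 on the Danielewski surface S = {xy = p(z)} is isomorphic to ℂ*. -/
/-- Completing the square in `x` on the quartic defining the fiber. -/
theorem danielewski_fiber_identity {b c d e α ξ χ κ : ℂ} (hξ : ξ ≠ 0)
    (hξ2 : ξ ^ 2 = α + b ^ 2 / 4 - c) (hχ : χ = (α * b - 2 * d) / (4 * ξ ^ 2))
    (hκ : κ = e - α ^ 2 / 4 + ξ ^ 2 * χ ^ 2) (x z : ℂ) :
    x * (x + 2 * z ^ 2 + b * z + α) + (z ^ 4 + b * z ^ 3 + c * z ^ 2 + d * z + e) =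
      (x + z ^ 2 + b / 2 * z + α / 2 + ξ * (z + χ)) *
        (x + z ^ 2 + b / 2 * z + α / 2 - ξ * (z + χ)) + κ := by
  have hχ' : 4 * ξ ^ 2 * χ = α * b - 2 * d := by rw [hχ]; field_simp
  linear_combination z ^ 2 * hξ2 + z / 2 * hχ' - hκ


/-- For `κ ≠ 0`, the coordinate `t = (ax−y)/(2a) + ξ(z+χ)` is a
bijection from the fiber `C^α` of the Danielewski surface `{xy = p(z)}`,
`p(z) = a(z⁴+bz³+cz²+dz+e)`, onto `ℂ*`, with the stated explicit inverse.
In particular the (general) fiber of the ℂ*-fibration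
`f(x,y,z) = ax + y + p''(z)/6` is isomorphic to `ℂ*`. -/
theorem stmt3 (a b c d e : ℂ) (ha : a ≠ 0)
    (α ξ χ κ : ℂ) (hξ : ξ ≠ 0) (hξ2 : ξ ^ 2 = α + b ^ 2 / 4 - c)
    (hχ : χ = (α * b - 2 * d) / (4 * ξ ^ 2))
    (hκ : κ = e - α ^ 2 / 4 + ξ ^ 2 * χ ^ 2) (hκ0 : κ ≠ 0)
    (Cα : Set (ℂ × ℂ × ℂ))
    (hCα : Cα = {q : ℂ × ℂ × ℂ |
      q.1 * q.2.1 = a * (q.2.2 ^ 4 + b * q.2.2 ^ 3 + c * q.2.2 ^ 2 + d * q.2.2 + e) ∧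
      a * q.1 + q.2.1 + 2 * a * q.2.2 ^ 2 + a * b * q.2.2 + a * α = 0})
    (T : ℂ × ℂ × ℂ → ℂ)
    (hT : ∀ q : ℂ × ℂ × ℂ, T q = (a * q.1 - q.2.1) / (2 * a) + ξ * (q.2.2 + χ))
    (Ψ : ℂ → ℂ × ℂ × ℂ)
    (hΨ : ∀ t : ℂ, Ψ t =
      let z : ℂ := (t ^ 2 + κ) / (2 * ξ * t) - χ
      let x : ℂ := t - ξ * (z + χ) - z ^ 2 - (b / 2) * z - α / 2
      let y : ℂ := -a * (x + 2 * z ^ 2 + b * z + α)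
      (x, y, z)) :
    Set.BijOn T Cα {t : ℂ | t ≠ 0} ∧ Set.InvOn Ψ T Cα {t : ℂ | t ≠ 0} := by
  have key := danielewski_fiber_identity hξ hξ2 hχ hκ
  have hfib : ∀ {x y z : ℂ}, (x, y, z) ∈ Cα →
      y = -a * (x + 2 * z ^ 2 + b * z + α) ∧
      T (x, y, z) = x + z ^ 2 + b / 2 * z + α / 2 + ξ * (z + χ) ∧
      T (x, y, z) * (T (x, y, z) - 2 * ξ * (z + χ)) = -κ := by
    intro x y z hq
    rw [hCα] at hq
    obtain ⟨h1, h2⟩ := hq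
    dsimp only at h1 h2
    have hy : y = -a * (x + 2 * z ^ 2 + b * z + α) := by linear_combination h2
    have hTq : T (x, y, z) = x + z ^ 2 + b / 2 * z + α / 2 + ξ * (z + χ) := by
      rw [hT, hy]
      field_simp
      ring
    refine ⟨hy, hTq, ?_⟩
    have h0 : x * (x + 2 * z ^ 2 + b * z + α) +
        (z ^ 4 + b * z ^ 3 + c * z ^ 2 + d * z + e) = 0 := by
      apply mul_left_cancel₀ ha
      rw [hy] at h1
      linear_combination -h1
    rw [hTq]
    linear_combination h0 - key x z
  have hmaps : Set.MapsTo T Cα {t : ℂ | t ≠ 0} := by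
    rintro ⟨x, y, z⟩ hq h0
    have h := (hfib hq).2.2
    rw [h0, zero_mul] at h
    exact hκ0 (neg_eq_zero.mp h.symm)
  have hleft : Set.LeftInvOn Ψ T Cα := by
    rintro ⟨x, y, z⟩ hq
    have ht : T (x, y, z) ≠ 0 := hmaps hq
    obtain ⟨hy, hTq, hprod⟩ := hfib hq
    have hz : (T (x, y, z) ^ 2 + κ) / (2 * ξ * T (x, y, z)) - χ = z := by
      rw [sub_eq_iff_eq_add, div_eq_iff (by simp [hξ, ht])]
      linear_combination hprod
    have hx : T (x, y, z) - ξ * (z + χ) - z ^ 2 - (b / 2) * z - α / 2 = x := by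
      rw [hTq]
      ring
    rw [hΨ]
    simp only [hz, hx, ← hy]
  have hinv : ∀ t : ℂ, t ≠ 0 → Ψ t ∈ Cα ∧ T (Ψ t) = t := by
    intro t ht
    obtain ⟨z, hz⟩ : ∃ z, z = (t ^ 2 + κ) / (2 * ξ * t) - χ := ⟨_, rfl⟩
    have hprod : t * (t - 2 * ξ * (z + χ)) = -κ := by
      rw [hz]
      field_simp
      ring
    obtain ⟨x, hx⟩ : ∃ x, x = t - ξ * (z + χ) - z ^ 2 - (b / 2) * z - α / 2 := ⟨_, rfl⟩
    have hΨt : Ψ t = (x, -a * (x + 2 * z ^ 2 + b * z + α), z) := by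
      rw [hΨ]
      simp only [← hz, ← hx]
    have hmem : Ψ t ∈ Cα := by
      rw [hΨt, hCα]
      refine ⟨?_, ?_⟩
      · have h := key x z
        have h1 : x + z ^ 2 + b / 2 * z + α / 2 + ξ * (z + χ) = t := by rw [hx]; ring
        have h2 : x + z ^ 2 + b / 2 * z + α / 2 - ξ * (z + χ) = t - 2 * ξ * (z + χ) := by
          rw [hx]; ring
        rw [h1, h2, hprod] at h
        dsimp only
        linear_combination -a * h
      · dsimp only
        ring
    refine ⟨hmem, ?_⟩
    rw [hΨt] at hmem ⊢
    rw [(hfib hmem).2.1, hx]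
    ring
  have hInv : Set.InvOn Ψ T Cα {t : ℂ | t ≠ 0} := ⟨hleft, fun t ht => (hinv t ht).2⟩
  exact ⟨hInv.bijOn hmaps fun t ht => (hinv t ht).1, hInv⟩
end

section
/- Let z₁, z₂, z₃, z₄ ∈ ℂ, a ∈ ℂ with a ≠ 0, and p(Z) = a(Z−z₁)(Z−z₂)(Z−z₃)(Z−z₄). Then for all (x,y,z) ∈ ℂ³ with x·y = p(z): a·(x + z² − (z₁+z₂)z + z₁z₂)·(x + z² − (z₃+z₄)z + z₃z₄) = x·(a·x + y + a·(2z² − (z₁+z₂+z₃+z₄)z + z₁z₂ + z₃z₄)). Moreover, a·(2z² − (z₁+z₂+z₃+z₄)z + z₁z₂ + z₃z₄) differs from p''(z)/6 by the constant a·(z₁z₂ + z₃z₄ − e₂/3), where e₂ = z₁z₂ + z₁z₃ + z₁z₄ + z₂z₃ + z₂z₄ + z₃z₄. (Hence, up to multiplying by a and adding a constant, the pushforward rational function (u − (z₁+z₂)v + z₁z₂w)(u − (z₃+z₄)v + z₃z₄w)/(uw − v²) restricts on the Danielewski surface to ax + y + p''(z)/6.) -/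
open Polynomial

/-- For `p(Z) = a(Z−z₁)(Z−z₂)(Z−z₃)(Z−z₄)`, on the Danielewski
surface `{xy = p(z)}` one has
`a(x+z²−(z₁+z₂)z+z₁z₂)(x+z²−(z₃+z₄)z+z₃z₄) = x(ax+y+a(2z²−(z₁+z₂+z₃+z₄)z+z₁z₂+z₃z₄))`,
and `a(2z²−(z₁+z₂+z₃+z₄)z+z₁z₂+z₃z₄)` differs from `p''(z)/6` by the constant
`a(z₁z₂+z₃z₄ − e₂/3)`. -/
theorem stmt4 (z₁ z₂ z₃ z₄ a : ℂ) (ha : a ≠ 0)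
    (p : Polynomial ℂ)
    (hp : p = C a * (X - C z₁) * (X - C z₂) * (X - C z₃) * (X - C z₄))
    (e₂ : ℂ)
    (he₂ : e₂ = z₁ * z₂ + z₁ * z₃ + z₁ * z₄ + z₂ * z₃ + z₂ * z₄ + z₃ * z₄) :
    (∀ x y z : ℂ, x * y = p.eval z →
      a * (x + z ^ 2 - (z₁ + z₂) * z + z₁ * z₂) *
          (x + z ^ 2 - (z₃ + z₄) * z + z₃ * z₄) =
        x * (a * x + y +
          a * (2 * z ^ 2 - (z₁ + z₂ + z₃ + z₄) * z + z₁ * z₂ + z₃ * z₄))) ∧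
    (∀ z : ℂ,
      a * (2 * z ^ 2 - (z₁ + z₂ + z₃ + z₄) * z + z₁ * z₂ + z₃ * z₄) -
          (derivative (derivative p)).eval z / 6 =
        a * (z₁ * z₂ + z₃ * z₄ - e₂ / 3)) := by
  subst hp he₂
  refine ⟨fun x y z h => ?_, fun z => ?_⟩
  · simp only [eval_mul, eval_sub, eval_C, eval_X] at h
    linear_combination -h
  · simp only [derivative_mul, derivative_sub, derivative_add, derivative_C, derivative_X,
      derivative_zero, derivative_one, eval_mul, eval_sub, eval_add, eval_C, eval_X,
      eval_zero, eval_one]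
    ring
end

section
/- Let p ∈ ℂ[z] be a nonconstant polynomial whose zeros are simple (p and p' are coprime), and let I = (xy − p(z)) be the principal ideal of ℂ[x,y,z] generated by xy − p(z). Let D be a ℂ-derivation of ℂ[x,y,z] such that D(xy − p(z)) ∈ I and D(x) ∈ (x) + I. Then D(z) ∈ (x) + I. Moreover, if F, G ∈ ℂ[x,y,z] are any polynomials with D(x) − x·F ∈ I and D(z) − x·G ∈ I, then the derivation D − F·HF − G·SF^x maps each of x, y, z into I; i.e. on the coordinate ring ℂ[S] = ℂ[x,y,z]/I one has D = (D(x)/x)·HF + (D(z)/x)·SF^x. -/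
open MvPolynomial

/-- `x` is not a zero divisor modulo `xy − p(z)` when `p ≠ 0`. -/
theorem mem_span_of_X_zero_mul_mem {p : Polynomial ℂ} (hp : p ≠ 0)
    {w : MvPolynomial (Fin 3) ℂ}
    (h : X 0 * w ∈ Ideal.span
      {(X 0 : MvPolynomial (Fin 3) ℂ) * X 1 - Polynomial.aeval (X 2) p}) :
    w ∈ Ideal.span {(X 0 : MvPolynomial (Fin 3) ℂ) * X 1 - Polynomial.aeval (X 2) p} := by
  rw [Ideal.mem_span_singleton] at h ⊢
  obtain ⟨c, hc⟩ := h
  have hx : Prime (X 0 : MvPolynomial (Fin 3) ℂ) := X_prime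
  have hndvd : ¬ (X 0 : MvPolynomial (Fin 3) ℂ) ∣ X 0 * X 1 - Polynomial.aeval (X 2) p := by
    rintro ⟨d, hd⟩
    refine hp (Polynomial.funext fun t => ?_)
    have ht := congrArg (aeval (![0, 0, t] : Fin 3 → ℂ)) hd
    rw [map_sub, ← Polynomial.aeval_algHom_apply] at ht
    simpa [Polynomial.aeval_def, Polynomial.eval₂_eq_eval_map] using ht
  obtain ⟨e, rfl⟩ := (hx.dvd_or_dvd (Dvd.intro w hc)).resolve_left hndvd
  exact ⟨e, mul_left_cancel₀ hx.ne_zero (by rw [hc]; ring)⟩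

/-- Let `p ∈ ℂ[z]` be nonconstant with simple zeros
(`p`, `p'` coprime), `I = (xy − p(z)) ⊆ ℂ[x,y,z]`, and `D` a ℂ-derivation of
`ℂ[x,y,z]` with `D(xy − p(z)) ∈ I` and `D(x) ∈ (x) + I`.  Then
`D(z) ∈ (x) + I`, and for any `F, G` with `D(x) − x·F ∈ I`, `D(z) − x·G ∈ I`
the derivation `D − F·HF − G·SF^x` maps `x, y, z` into `I`; i.e. on `ℂ[S]`
one has `D = (D(x)/x)·HF + (D(z)/x)·SF^x`. -/
theorem stmt5 (p : Polynomial ℂ) (hp : 0 < p.natDegree)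
    (hcop : IsCoprime p (Polynomial.derivative p))
    (I : Ideal (MvPolynomial (Fin 3) ℂ))
    (hI : I = Ideal.span {(X 0 : MvPolynomial (Fin 3) ℂ) * X 1 - Polynomial.aeval (X 2) p})
    (D : Derivation ℂ (MvPolynomial (Fin 3) ℂ) (MvPolynomial (Fin 3) ℂ))
    (hD : D ((X 0 : MvPolynomial (Fin 3) ℂ) * X 1 - Polynomial.aeval (X 2) p) ∈ I)
    (hDx : D (X 0) ∈ Ideal.span {(X 0 : MvPolynomial (Fin 3) ℂ)} ⊔ I)
    (HF SFx : Derivation ℂ (MvPolynomial (Fin 3) ℂ) (MvPolynomial (Fin 3) ℂ))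
    (hHF : HF = mkDerivation ℂ (![X 0, -X 1, 0] : Fin 3 → MvPolynomial (Fin 3) ℂ))
    (hSFx : SFx = mkDerivation ℂ
      (![0, Polynomial.aeval (X 2) (Polynomial.derivative p), X 0] :
        Fin 3 → MvPolynomial (Fin 3) ℂ)) :
    D (X 2) ∈ Ideal.span {(X 0 : MvPolynomial (Fin 3) ℂ)} ⊔ I ∧
    ∀ F G : MvPolynomial (Fin 3) ℂ,
      D (X 0) - X 0 * F ∈ I → D (X 2) - X 0 * G ∈ I →
      (D - F • HF - G • SFx) (X 0) ∈ I ∧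
      (D - F • HF - G • SFx) (X 1) ∈ I ∧
      (D - F • HF - G • SFx) (X 2) ∈ I := by
  obtain rfl := hHF
  obtain rfl := hSFx
  have hDp : D (X 0 * X 1 - Polynomial.aeval (X 2) p) = X 0 * D (X 1) + X 1 * D (X 0)
      - Polynomial.aeval (X 2) (Polynomial.derivative p) * D (X 2) := by
    rw [map_sub, Derivation.leibniz, Derivation.map_aeval]
    simp only [smul_eq_mul]
  rw [hDp] at hD
  set q : MvPolynomial (Fin 3) ℂ := X 0 * X 1 - Polynomial.aeval (X 2) p with hq
  have hqI : q ∈ I := hI ▸ Ideal.mem_span_singleton_self q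
  refine ⟨?_, fun F G hF hG => ⟨?_, ?_, ?_⟩⟩
  · set J := Ideal.span {(X 0 : MvPolynomial (Fin 3) ℂ)} ⊔ I
    have hIJ : I ≤ J := le_sup_right
    have hx : (X 0 : MvPolynomial (Fin 3) ℂ) ∈ J :=
      (le_sup_left : _ ≤ J) (Ideal.mem_span_singleton_self _)
    obtain ⟨a, b, hab⟩ := hcop
    have hab' := congrArg (Polynomial.aeval (X 2 : MvPolynomial (Fin 3) ℂ)) hab
    simp only [map_add, map_mul, map_one] at hab'
    set A := Polynomial.aeval (X 2 : MvPolynomial (Fin 3) ℂ) a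
    set B := Polynomial.aeval (X 2 : MvPolynomial (Fin 3) ℂ) b
    have key : D (X 2) = (A * D (X 2) * X 1 + B * D (X 1)) * X 0 - A * D (X 2) * q
        + B * X 1 * D (X 0)
        - B * (X 0 * D (X 1) + X 1 * D (X 0)
          - Polynomial.aeval (X 2) (Polynomial.derivative p) * D (X 2)) := by
      rw [hq]
      linear_combination (-D (X 2)) * hab'
    rw [key]
    exact J.sub_mem (J.add_mem (J.sub_mem (J.mul_mem_left _ hx) (J.mul_mem_left _ (hIJ hqI)))
      (J.mul_mem_left _ hDx)) (J.mul_mem_left _ (hIJ hD))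
  · simpa [mkDerivation_X, mul_comm] using hF
  · suffices h : X 0 * (D (X 1) + F * X 1
        - G * Polynomial.aeval (X 2) (Polynomial.derivative p)) ∈ I by
      rw [hI] at h ⊢
      simpa [mkDerivation_X] using mem_span_of_X_zero_mul_mem (by rintro rfl; simp at hp) h
    have key : X 0 * (D (X 1) + F * X 1 - G * Polynomial.aeval (X 2) (Polynomial.derivative p))
        = (X 0 * D (X 1) + X 1 * D (X 0)
          - Polynomial.aeval (X 2) (Polynomial.derivative p) * D (X 2))
          + Polynomial.aeval (X 2) (Polynomial.derivative p) * (D (X 2) - X 0 * G)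
          - X 1 * (D (X 0) - X 0 * F) := by ring
    rw [key]
    exact I.sub_mem (I.add_mem hD (I.mul_mem_left _ hG)) (I.mul_mem_left _ hF)
  · simpa [mkDerivation_X, mul_comm] using hG
end
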